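/- arXiv:0907.1376 — 2 statements merged into one kernel-verified Lean document; each statement's English description precedes it below -/
import Mathlib

section
/- The number of τ-isomorphism classes of spherical bitrades in τ-representation of size 6 is exactly 3. -/
/-- The set of points moved by a permutation. -/
def mov (σ : Equiv.Perm ℕ) : Set ℕ := {x | σ x ≠ x}

/-- The underlying set `Γ = mov(τ₁) ∪ mov(τ₂) ∪ mov(τ₃)` of a triple of permutations. -/
def Gam (τ : Fin 3 → Equiv.Perm ℕ) : Set ℕ := mov (τ 0) ∪ mov (τ 1) ∪ mov (τ 2)

/-- A bitrade in τ-representation: a triple `[τ₁, τ₂, τ₃]` of permutations of the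
finite set `Γ = mov(τ₁) ∪ mov(τ₂) ∪ mov(τ₃)` (all permutations composed left to
right) satisfying (T1) `τ₁τ₂τ₃ = 1`, (T2) any cycle of `τ_i` and any cycle of `τ_j`
(`i < j`) move at most one common point, and (T3) each `τ_i` is fixed-point-free
on `Γ`. -/
structure IsTauRep (τ : Fin 3 → Equiv.Perm ℕ) : Prop where
  fin : (Gam τ).Finite
  t1 : ∀ x, τ 2 (τ 1 (τ 0 x)) = x
  t2 : ∀ i j : Fin 3, i < j → ∀ x y : ℕ, x ≠ y →
    ¬((τ i).SameCycle x y ∧ (τ j).SameCycle x y)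
  t3 : ∀ i : Fin 3, ∀ x ∈ Gam τ, τ i x ≠ x

/-- The same-cycle setoid on the set of points moved by `σ`;
its classes are the (nontrivial) cycles of `σ`. -/
def cycSetoidOn (σ : Equiv.Perm ℕ) : Setoid (mov σ) :=
  ⟨fun a b => σ.SameCycle a.1 b.1,
    ⟨fun a => Equiv.Perm.SameCycle.refl σ a.1,
     fun h => h.symm, fun h h' => h.trans h'⟩⟩

/-- `zc σ` is the number of cycles of `σ`. -/
noncomputable def zc (σ : Equiv.Perm ℕ) : ℕ := Nat.card (Quotient (cycSetoidOn σ))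

/-- (T4): the group `⟨τ₁, τ₂, τ₃⟩` acts transitively on `Γ`. -/
def TransOn (τ : Fin 3 → Equiv.Perm ℕ) : Prop :=
  ∀ x ∈ Gam τ, ∀ y ∈ Gam τ,
    ∃ g ∈ Subgroup.closure ({τ 0, τ 1, τ 2} : Set (Equiv.Perm ℕ)), g x = y

/-- A spherical bitrade in τ-representation: (T4) holds and the genus defined by
Euler's formula `order = size + 2 - 2g` is zero. -/
def Spherical (τ : Fin 3 → Equiv.Perm ℕ) : Prop :=
  IsTauRep τ ∧ TransOn τ ∧
    zc (τ 0) + zc (τ 1) + zc (τ 2) = Nat.card (Gam τ) + 2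

/-- A bitrade in τ-representation is bicyclic if some `τ_j` has exactly two cycles. -/
def Bicyclic (τ : Fin 3 → Equiv.Perm ℕ) : Prop := ∃ j : Fin 3, zc (τ j) = 2

/-- The inverse `Z⁻¹ = [τ₁⁻¹, τ₂⁻¹, τ₂τ₁]` of a bitrade in τ-representation
(`τ₂τ₁`, composed left to right, is `τ 0 * τ 1` in Lean's convention). -/
def ZInv (τ : Fin 3 → Equiv.Perm ℕ) : Fin 3 → Equiv.Perm ℕ :=
  ![(τ 0)⁻¹, (τ 1)⁻¹, τ 0 * τ 1]

/-- `SlideRel τ x j u τ'` says that `τ'` is the result of the slide expansion of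
`τ` at the point `x ∈ Γ` in direction `j`, with new point `u ∉ Γ`.  Writing
`k = j+1`, `l = j+2`, `w = xτ_j`, `a = xτ_j⁻¹`, `b = wτ_j`, `z = xτ_k`,
`y = wτ_l⁻¹`, the preconditions are that the `τ_j`-cycle through `x` has length at
least 3 and that the `τ_k`-cycle through `x` and the `τ_l`-cycle through `w` have
no common point; the new permutations send `a ↦ u ↦ b`, `x ↦ w ↦ x` (direction `j`),
insert `u` after `x` (direction `k`) and insert `u` between `y` and `w`
(direction `l`), agreeing with the old ones elsewhere. -/
def SlideRel (τ : Fin 3 → Equiv.Perm ℕ) (x : ℕ) (j : Fin 3) (u : ℕ)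
    (τ' : Fin 3 → Equiv.Perm ℕ) : Prop :=
  x ∈ Gam τ ∧ u ∉ Gam τ ∧
  τ j x ≠ x ∧ τ j (τ j x) ≠ x ∧
  (∀ p : ℕ, (τ (j + 1)).SameCycle x p → (τ (j + 2)).SameCycle (τ j x) p → False) ∧
  (τ' j ((τ j)⁻¹ x) = u ∧ τ' j u = τ j (τ j x) ∧
    τ' j x = τ j x ∧ τ' j (τ j x) = x ∧
    ∀ p : ℕ, p ≠ (τ j)⁻¹ x → p ≠ u → p ≠ x → p ≠ τ j x → τ' j p = τ j p) ∧
  (τ' (j + 1) x = u ∧ τ' (j + 1) u = τ (j + 1) x ∧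
    ∀ p : ℕ, p ≠ x → p ≠ u → τ' (j + 1) p = τ (j + 1) p) ∧
  (τ' (j + 2) ((τ (j + 2))⁻¹ (τ j x)) = u ∧ τ' (j + 2) u = τ j x ∧
    ∀ p : ℕ, p ≠ (τ (j + 2))⁻¹ (τ j x) → p ≠ u → τ' (j + 2) p = τ (j + 2) p)

/-- τ-isomorphism of bitrades in τ-representation (restricted, without loss of
generality, to triples of permutations of `ℕ`): `τ` and `ν` are τ-isomorphic if there
is a permutation `θ` with `θ⁻¹ τ_i θ = ν_i` for `i = 1, 2, 3` (left-to-right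
conjugation `θ⁻¹σθ` is `θ * σ * θ⁻¹` in Lean's convention). -/
def TauIso (τ ν : Fin 3 → Equiv.Perm ℕ) : Prop :=
  ∃ θ : Equiv.Perm ℕ, ∀ i : Fin 3, θ * τ i * θ⁻¹ = ν i

/-- The τ-isomorphism setoid on any collection of bitrades in τ-representation. -/
def tauIsoSetoid (S : Set (Fin 3 → Equiv.Perm ℕ)) : Setoid S where
  r τ ν := TauIso τ.1 ν.1
  iseqv := by
    refine ⟨fun τ => ⟨1, by simp⟩, ?_, ?_⟩
    · rintro τ ν ⟨θ, hθ⟩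
      exact ⟨θ⁻¹, fun i => by rw [← hθ i]; group⟩
    · rintro τ ν ρ ⟨θ, hθ⟩ ⟨θ', hθ'⟩
      exact ⟨θ' * θ, fun i => by rw [← hθ' i, ← hθ i]; group⟩

/-- `τ` restricted to `{1, …, 6}` is a hexagon `p` whose edges are alternately the
transpositions of `τ (i + 1)` and of `τ (i + 2)`. -/
def IsHexagon (i : Fin 3) (τ : Fin 3 → Equiv.Perm ℕ) (p : Fin 6 → ℕ) : Prop :=
  Function.Injective p ∧ Set.range p = Set.Icc 1 6 ∧
  (τ (i + 1) (p 0) = p 1 ∧ τ (i + 1) (p 1) = p 0 ∧ τ (i + 1) (p 2) = p 3 ∧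
    τ (i + 1) (p 3) = p 2 ∧ τ (i + 1) (p 4) = p 5 ∧ τ (i + 1) (p 5) = p 4) ∧
  (τ (i + 2) (p 0) = p 5 ∧ τ (i + 2) (p 1) = p 2 ∧ τ (i + 2) (p 2) = p 1 ∧
    τ (i + 2) (p 3) = p 4 ∧ τ (i + 2) (p 4) = p 3 ∧ τ (i + 2) (p 5) = p 0)

/-- The spherical bitrades in τ-representation on `{1, …, 6}`. -/
def sphericalSix : Set (Fin 3 → Equiv.Perm ℕ) :=
  {τ | Spherical τ ∧ Gam τ = Set.Icc 1 6}

theorem apply_mem_mov {σ : Equiv.Perm ℕ} {x : ℕ} (hx : x ∈ mov σ) : σ x ∈ mov σ :=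
  fun h => hx (σ.injective h)

theorem mov_subset_Gam (τ : Fin 3 → Equiv.Perm ℕ) (i : Fin 3) : mov (τ i) ⊆ Gam τ := by
  intro x hx
  fin_cases i
  · exact Or.inl (Or.inl hx)
  · exact Or.inl (Or.inr hx)
  · exact Or.inr hx

theorem IsTauRep.mov_eq {τ : Fin 3 → Equiv.Perm ℕ} (h : IsTauRep τ) (i : Fin 3) :
    mov (τ i) = Gam τ :=
  (mov_subset_Gam τ i).antisymm fun x hx => h.t3 i x hx

theorem two_le_card_cycle {σ : Equiv.Perm ℕ} [Fintype (mov σ)]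
    [DecidableEq (Quotient (cycSetoidOn σ))] (q : Quotient (cycSetoidOn σ)) :
    2 ≤ (Finset.univ.filter fun x : mov σ =>
      (Quotient.mk _ x : Quotient (cycSetoidOn σ)) = q).card := by
  induction q using Quotient.inductionOn with
  | h x =>
    refine Finset.one_lt_card.2 ⟨x, by simp, ⟨σ x, apply_mem_mov x.2⟩, ?_, ?_⟩
    · simp only [Finset.mem_filter, Finset.mem_univ, true_and]
      exact Quotient.sound (show σ.SameCycle (σ x) x from
        (Equiv.Perm.SameCycle.refl σ x.1).apply_left)
    · intro h
      exact x.2 (congrArg Subtype.val h).symm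

theorem zc_le_three {σ : Equiv.Perm ℕ} (hσ : mov σ = Set.Icc 1 6) :
    zc σ ≤ 3 ∧ (zc σ = 3 → ∀ x, σ (σ x) = x) := by
  classical
  have : Finite (mov σ) := by rw [hσ]; infer_instance
  have : Fintype (mov σ) := Fintype.ofFinite _
  have hcard : Fintype.card (mov σ) = 6 := by
    rw [← Nat.card_eq_fintype_card, hσ]; simp
  have : Fintype (Quotient (cycSetoidOn σ)) := Fintype.ofFinite _
  have hz : zc σ = Fintype.card (Quotient (cycSetoidOn σ)) := Nat.card_eq_fintype_card
  have hsum := Finset.card_eq_sum_card_fiberwise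
    (f := fun x : mov σ => (Quotient.mk _ x : Quotient (cycSetoidOn σ)))
    (s := Finset.univ) (t := Finset.univ) (by simp)
  rw [Finset.card_univ, hcard] at hsum
  refine ⟨?_, fun h3 x => ?_⟩
  · have := Finset.card_nsmul_le_sum (Finset.univ : Finset (Quotient (cycSetoidOn σ))) _ 2
      fun q _ => two_le_card_cycle q
    rw [Finset.card_univ, ← hz, smul_eq_mul] at this
    omega
  · by_contra hne
    have hx : x ∈ mov σ := fun h => hne (by rw [h, h])
    have hlt : ∑ _q : Quotient (cycSetoidOn σ), 2 < ∑ q : Quotient (cycSetoidOn σ),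
        (Finset.univ.filter fun x : mov σ =>
          (Quotient.mk _ x : Quotient (cycSetoidOn σ)) = q).card := by
      refine Finset.sum_lt_sum (fun q _ => two_le_card_cycle q)
        ⟨Quotient.mk _ ⟨x, hx⟩, Finset.mem_univ _, ?_⟩
      refine Finset.two_lt_card.2 ⟨⟨x, hx⟩, by simp, ⟨σ x, apply_mem_mov hx⟩, ?_,
        ⟨σ (σ x), apply_mem_mov (apply_mem_mov hx)⟩, ?_, ?_, ?_, ?_⟩
      · simp only [Finset.mem_filter, Finset.mem_univ, true_and]
        exact Quotient.sound (show σ.SameCycle (σ x) x from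
          (Equiv.Perm.SameCycle.refl σ x).apply_left)
      · simp only [Finset.mem_filter, Finset.mem_univ, true_and]
        exact Quotient.sound (show σ.SameCycle (σ (σ x)) x from
          (Equiv.Perm.SameCycle.refl σ x).apply_left.apply_left)
      · exact fun h => hx (congrArg Subtype.val h).symm
      · exact fun h => hne (congrArg Subtype.val h).symm
      · exact fun h => hx (σ.injective (congrArg Subtype.val h).symm)
    simp only [Finset.sum_const, Finset.card_univ, ← hz, h3, smul_eq_mul] at hlt
    omega

theorem length_le_six_of_nodup {l : List ℕ} (hl : l.Nodup) (h : ∀ x ∈ l, x ∈ Set.Icc 1 6) :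
    l.length ≤ 6 := by
  rw [← List.toFinset_card_of_nodup hl]
  refine (Finset.card_le_card (t := Finset.Icc 1 6) fun x hx => ?_).trans (by simp)
  simpa using h x (by simpa using hx)

theorem range_eq_Icc_of_injective {p : Fin 6 → ℕ} (hp : Function.Injective p)
    (h : ∀ m, p m ∈ Set.Icc 1 6) : Set.range p = Set.Icc 1 6 := by
  have := Finset.eq_of_subset_of_card_le (s := Finset.univ.image p) (t := Finset.Icc 1 6)
    (by intro x hx; obtain ⟨m, -, rfl⟩ := Finset.mem_image.1 hx; simpa using h m)
    (by rw [Finset.card_image_of_injective _ hp]; simp)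
  simpa using congrArg (fun s : Finset ℕ => (s : Set ℕ)) this

/-- Two fixed-point-free involutions of six points which never agree form a hexagon. -/
theorem exists_hexagon {a b : Equiv.Perm ℕ} (ha : ∀ x, a (a x) = x) (hb : ∀ x, b (b x) = x)
    (hma : mov a = Set.Icc 1 6) (hmb : mov b = Set.Icc 1 6)
    (hab : ∀ x ∈ Set.Icc 1 6, a x ≠ b x) :
    ∃ p : Fin 6 → ℕ, Function.Injective p ∧ Set.range p = Set.Icc 1 6 ∧
      (a (p 0) = p 1 ∧ a (p 1) = p 0 ∧ a (p 2) = p 3 ∧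
        a (p 3) = p 2 ∧ a (p 4) = p 5 ∧ a (p 5) = p 4) ∧
      (b (p 0) = p 5 ∧ b (p 1) = p 2 ∧ b (p 2) = p 1 ∧
        b (p 3) = p 4 ∧ b (p 4) = p 3 ∧ b (p 5) = p 0) := by
  have fa : ∀ x ∈ Set.Icc 1 6, a x ≠ x := fun x hx => by rw [← hma] at hx; exact hx
  have fb : ∀ x ∈ Set.Icc 1 6, b x ≠ x := fun x hx => by rw [← hmb] at hx; exact hx
  have ma : ∀ x ∈ Set.Icc 1 6, a x ∈ Set.Icc 1 6 := fun x hx => by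
    rw [← hma] at hx ⊢; exact apply_mem_mov hx
  have mb : ∀ x ∈ Set.Icc 1 6, b x ∈ Set.Icc 1 6 := fun x hx => by
    rw [← hmb] at hx ⊢; exact apply_mem_mov hx
  obtain ⟨p0, h0⟩ : ∃ x, x ∈ Set.Icc 1 6 := ⟨1, by simp⟩
  obtain ⟨p1, e1⟩ : ∃ x, a p0 = x := ⟨_, rfl⟩
  obtain ⟨p2, e2⟩ : ∃ x, b p1 = x := ⟨_, rfl⟩
  obtain ⟨p3, e3⟩ : ∃ x, a p2 = x := ⟨_, rfl⟩
  obtain ⟨p4, e4⟩ : ∃ x, b p3 = x := ⟨_, rfl⟩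
  obtain ⟨p5, e5⟩ : ∃ x, a p4 = x := ⟨_, rfl⟩
  have e1' : a p1 = p0 := by rw [← e1, ha]
  have e2' : b p2 = p1 := by rw [← e2, hb]
  have e3' : a p3 = p2 := by rw [← e3, ha]
  have e4' : b p4 = p3 := by rw [← e4, hb]
  have e5' : a p5 = p4 := by rw [← e5, ha]
  have h1 : p1 ∈ Set.Icc 1 6 := e1 ▸ ma _ h0
  have h2 : p2 ∈ Set.Icc 1 6 := e2 ▸ mb _ h1
  have h3 : p3 ∈ Set.Icc 1 6 := e3 ▸ ma _ h2
  have h4 : p4 ∈ Set.Icc 1 6 := e4 ▸ mb _ h3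
  have h5 : p5 ∈ Set.Icc 1 6 := e5 ▸ ma _ h4
  have n40 : p4 ≠ p0 := by
    intro h40
    obtain ⟨u, hu, hu'⟩ : ∃ u ∈ Finset.Icc 1 6, u ∉ ({p0, p1, p2, p3} : Finset ℕ) :=
      Finset.exists_mem_notMem_of_card_lt_card (Finset.card_le_four.trans_lt (by simp))
    have hu : u ∈ Set.Icc 1 6 := by simpa using hu
    simp only [Finset.mem_insert, Finset.mem_singleton, not_or] at hu'
    have := length_le_six_of_nodup (l := [p0, p1, p2, p3, u, a u, b u]) (by
      simp only [List.nodup_cons, List.mem_cons, List.not_mem_nil, List.nodup_nil]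
      grind) (by
      simp only [List.mem_cons, List.not_mem_nil]
      grind)
    simp at this
  have hd : [p0, p1, p2, p3, p4, p5].Nodup := by
    simp only [List.nodup_cons, List.mem_cons, List.not_mem_nil, List.nodup_nil]
    grind
  have e6 : b p5 = p0 := by
    by_contra hne
    have := length_le_six_of_nodup (l := [p0, p1, p2, p3, p4, p5, b p5]) (by
      simp only [List.nodup_cons, List.mem_cons, List.not_mem_nil, List.nodup_nil] at hd ⊢
      grind) (by
      simp only [List.mem_cons, List.not_mem_nil]
      grind)
    simp at this
  have e6' : b p0 = p5 := by rw [← e6, hb]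
  have hinj : Function.Injective ![p0, p1, p2, p3, p4, p5] := by
    rw [← List.nodup_ofFn]
    simpa [List.ofFn_succ] using hd
  refine ⟨![p0, p1, p2, p3, p4, p5], hinj, range_eq_Icc_of_injective hinj ?_,
    ⟨e1, e1', e3, e3', e5, e5'⟩, ⟨e6', e2, e2', e4, e4', e6⟩⟩
  intro m
  fin_cases m <;> assumption

theorem fin_three_cases : ∀ i k : Fin 3, k = i ∨ k = i + 1 ∨ k = i + 2 := by
  decide

theorem IsTauRep.mul_eq_one {τ : Fin 3 → Equiv.Perm ℕ} (h : IsTauRep τ) (i : Fin 3) :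
    τ (i + 2) * τ (i + 1) * τ i = 1 := by
  have h0 : τ 2 * τ 1 * τ 0 = 1 := Equiv.ext h.t1
  fin_cases i
  · exact h0
  · change τ 0 * τ 2 * τ 1 = 1
    rw [mul_assoc]
    exact mul_eq_one_comm.1 h0
  · change τ 1 * τ 0 * τ 2 = 1
    rw [mul_assoc] at h0
    exact mul_eq_one_comm.1 h0

theorem IsTauRep.apply_ne {τ : Fin 3 → Equiv.Perm ℕ} (h : IsTauRep τ) {i j : Fin 3}
    (hij : i ≠ j) {x : ℕ} (hx : x ∈ Gam τ) : τ i x ≠ τ j x := by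
  intro he
  have hi : (τ i).SameCycle x (τ i x) := (Equiv.Perm.SameCycle.refl _ x).apply_right
  have hj : (τ j).SameCycle x (τ i x) := he ▸ (Equiv.Perm.SameCycle.refl _ x).apply_right
  have hne := (h.t3 i x hx).symm
  rcases lt_or_gt_of_ne hij with hlt | hlt
  · exact h.t2 i j hlt _ _ hne ⟨hi, hj⟩
  · exact h.t2 j i hlt _ _ hne ⟨hj, hi⟩

theorem exists_isHexagon {τ : Fin 3 → Equiv.Perm ℕ} (hτ : τ ∈ sphericalSix) :
    ∃ i p, IsHexagon i τ p := by
  obtain ⟨⟨hrep, -, hz⟩, hG⟩ := hτ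
  have hm : ∀ i, mov (τ i) = Set.Icc 1 6 := fun i => (hrep.mov_eq i).trans hG
  have hle : ∀ i, zc (τ i) ≤ 3 := fun i => (zc_le_three (hm i)).1
  have hz : zc (τ 0) + zc (τ 1) + zc (τ 2) = 8 := by simpa [hG] using hz
  obtain ⟨i, h1, h2⟩ : ∃ i : Fin 3, zc (τ (i + 1)) = 3 ∧ zc (τ (i + 2)) = 3 := by
    have := hle 0
    have := hle 1
    have := hle 2
    by_cases h0 : zc (τ 0) = 2
    · exact ⟨0, by change zc (τ 1) = 3; omega, by change zc (τ 2) = 3; omega⟩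
    by_cases h0 : zc (τ 1) = 2
    · exact ⟨1, by change zc (τ 2) = 3; omega, by change zc (τ 0) = 3; omega⟩
    · exact ⟨2, by change zc (τ 0) = 3; omega, by change zc (τ 1) = 3; omega⟩
  obtain ⟨p, hp⟩ := exists_hexagon ((zc_le_three (hm _)).2 h1) ((zc_le_three (hm _)).2 h2)
    (hm _) (hm _) fun x hx => hrep.apply_ne ((by decide : ∀ i : Fin 3, i + 1 ≠ i + 2) i) (hG ▸ hx)
  exact ⟨i, p, hp⟩

theorem IsHexagon.tauIso {i : Fin 3} {τ ν : Fin 3 → Equiv.Perm ℕ} {p q : Fin 6 → ℕ}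
    (hp : IsHexagon i τ p) (hq : IsHexagon i ν q) (hτ : τ ∈ sphericalSix)
    (hν : ν ∈ sphericalSix) : TauIso τ ν := by
  classical
  obtain ⟨pinj, prange, ⟨a0, a1, a2, a3, a4, a5⟩, b0, b1, b2, b3, b4, b5⟩ := hp
  obtain ⟨qinj, qrange, ⟨c0, c1, c2, c3, c4, c5⟩, d0, d1, d2, d3, d4, d5⟩ := hq
  let ep := (Equiv.ofInjective p pinj).trans (Equiv.setCongr prange)
  let eq := (Equiv.ofInjective q qinj).trans (Equiv.setCongr qrange)
  let θ : Equiv.Perm ℕ := Equiv.Perm.ofSubtype (ep.symm.trans eq)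
  have hθ : ∀ m, θ (p m) = q m := by
    intro m
    have hm : p m ∈ Set.Icc 1 6 := prange ▸ Set.mem_range_self m
    have he : ep.symm ⟨p m, hm⟩ = m := by
      rw [Equiv.symm_apply_eq]; rfl
    rw [show θ (p m) = _ from Equiv.Perm.ofSubtype_apply_of_mem _ hm]
    simp only [Equiv.trans_apply, he]
    rfl
  have hθ' : ∀ x ∉ Set.Icc 1 6, θ x = x := fun x hx =>
    Equiv.Perm.ofSubtype_apply_of_not_mem _ hx
  have fix : ∀ {μ : Fin 3 → Equiv.Perm ℕ}, μ ∈ sphericalSix → ∀ k, ∀ x ∉ Set.Icc 1 6,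
      μ k x = x := by
    intro μ hμ k x hx
    by_contra h
    exact hx (hμ.2 ▸ mov_subset_Gam μ k h)
  have key : ∀ k, (∀ m, θ (τ k (p m)) = ν k (q m)) → θ * τ k * θ⁻¹ = ν k := by
    intro k hk
    rw [mul_inv_eq_iff_eq_mul]
    ext x
    simp only [Equiv.Perm.mul_apply]
    by_cases hx : x ∈ Set.Icc 1 6
    · obtain ⟨m, rfl⟩ : x ∈ Set.range p := prange ▸ hx
      rw [hk, hθ]
    · rw [fix hτ k x hx, hθ' x hx, fix hν k x hx]
  have k1 : θ * τ (i + 1) * θ⁻¹ = ν (i + 1) := by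
    refine key _ fun m => ?_
    fin_cases m <;> simp [*]
  have k2 : θ * τ (i + 2) * θ⁻¹ = ν (i + 2) := by
    refine key _ fun m => ?_
    fin_cases m <;> simp [*]
  have k0 : θ * τ i * θ⁻¹ = ν i := by
    rw [eq_inv_of_mul_eq_one_right (hτ.1.1.mul_eq_one i),
      eq_inv_of_mul_eq_one_right (hν.1.1.mul_eq_one i), ← k1, ← k2]
    group
  refine ⟨θ, fun k => ?_⟩
  obtain rfl | rfl | rfl : k = i ∨ k = i + 1 ∨ k = i + 2 := fin_three_cases i k
  exacts [k0, k1, k2]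

theorem IsHexagon.mul_self_eq_one_iff {i : Fin 3} {τ : Fin 3 → Equiv.Perm ℕ} {p : Fin 6 → ℕ}
    (hp : IsHexagon i τ p) (hτ : τ ∈ sphericalSix) (k : Fin 3) :
    τ k * τ k = 1 ↔ k ≠ i := by
  obtain ⟨pinj, prange, ⟨a0, a1, a2, a3, a4, a5⟩, b0, b1, b2, b3, b4, b5⟩ := hp
  have key : ∀ k, (∀ m, τ k (τ k (p m)) = p m) → τ k * τ k = 1 := by
    intro k hk
    ext x
    by_cases hx : x ∈ Set.Icc 1 6
    · obtain ⟨m, rfl⟩ : x ∈ Set.range p := prange ▸ hx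
      exact hk m
    · have : τ k x = x := by
        by_contra h
        exact hx (hτ.2 ▸ mov_subset_Gam τ k h)
      simp [this]
  obtain rfl | rfl | rfl : k = i ∨ k = i + 1 ∨ k = i + 2 := fin_three_cases i k
  · simp only [ne_eq, not_true, iff_false]
    intro h
    have h1 := hτ.1.1.mul_eq_one k
    have h2 : τ k = τ (k + 2) * τ (k + 1) := by
      rw [eq_inv_of_mul_eq_one_left h1, inv_eq_of_mul_eq_one_left h]
    have h3 : τ k (τ k (p 0)) = p 0 := by rw [← Equiv.Perm.mul_apply, h]; rfl
    rw [h2] at h3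
    simp only [Equiv.Perm.mul_apply, a0, b1, a2, b3] at h3
    exact absurd (pinj h3) (by decide)
  · refine iff_of_true (key _ fun m => ?_) ((by decide : ∀ i : Fin 3, i + 1 ≠ i) i)
    fin_cases m <;> simp [*]
  · refine iff_of_true (key _ fun m => ?_) ((by decide : ∀ i : Fin 3, i + 2 ≠ i) i)
    fin_cases m <;> simp [*]

theorem TauIso.mul_self_eq_one {τ ν : Fin 3 → Equiv.Perm ℕ} (h : TauIso τ ν) {k : Fin 3}
    (hk : τ k * τ k = 1) : ν k * ν k = 1 := by
  obtain ⟨θ, hθ⟩ := h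
  rw [← hθ k, show θ * τ k * θ⁻¹ * (θ * τ k * θ⁻¹) = θ * (τ k * τ k) * θ⁻¹ by group, hk]
  group

theorem Gam_rotate (τ : Fin 3 → Equiv.Perm ℕ) : Gam (fun k => τ (k + 1)) = Gam τ := by
  change mov (τ 1) ∪ mov (τ 2) ∪ mov (τ 0) = mov (τ 0) ∪ mov (τ 1) ∪ mov (τ 2)
  rw [Set.union_comm, Set.union_assoc]

theorem rotate_mem_sphericalSix {τ : Fin 3 → Equiv.Perm ℕ} (hτ : τ ∈ sphericalSix) :
    (fun k => τ (k + 1)) ∈ sphericalSix := by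
  obtain ⟨⟨hrep, htrans, hz⟩, hG⟩ := hτ
  refine ⟨⟨⟨?_, ?_, ?_, ?_⟩, ?_, ?_⟩, ?_⟩
  · rw [Gam_rotate]; exact hrep.fin
  · exact fun x => Equiv.ext_iff.1 (hrep.mul_eq_one 1) x
  · intro i j hij x y hxy h
    have hne : i + 1 ≠ j + 1 := by simpa using hij.ne
    rcases lt_or_gt_of_ne hne with hlt | hlt
    · exact hrep.t2 _ _ hlt x y hxy h
    · exact hrep.t2 _ _ hlt x y hxy h.symm
  · intro i x hx
    rw [Gam_rotate] at hx
    exact hrep.t3 _ x hx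
  · intro x hx y hy
    rw [Gam_rotate] at hx hy
    have : ({τ 1, τ 2, τ 0} : Set (Equiv.Perm ℕ)) = {τ 0, τ 1, τ 2} := by
      ext; simp only [Set.mem_insert_iff, Set.mem_singleton_iff]; tauto
    change ∃ g ∈ Subgroup.closure ({τ 1, τ 2, τ 0} : Set (Equiv.Perm ℕ)), g x = y
    rw [this]
    exact htrans x hx y hy
  · rw [Gam_rotate]
    change zc (τ 1) + zc (τ 2) + zc (τ 0) = _
    omega
  · rw [Gam_rotate, hG]

theorem IsHexagon.rotate {i : Fin 3} {τ : Fin 3 → Equiv.Perm ℕ} {p : Fin 6 → ℕ}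
    (hp : IsHexagon (i + 1) τ p) : IsHexagon i (fun k => τ (k + 1)) p := by
  unfold IsHexagon at *
  simp only [add_right_comm i _ 1]
  exact hp

/-- The involution `(1 2)(3 4)(5 6)`. -/
def hexA : Equiv.Perm ℕ :=
  Function.Involutive.toPerm
    (fun x => if x = 0 ∨ 6 < x then x else if x % 2 = 0 then x - 1 else x + 1)
    (by intro x; grind)

/-- The involution `(2 3)(4 5)(6 1)`. -/
def hexB : Equiv.Perm ℕ :=
  Function.Involutive.toPerm
    (fun x => if x = 0 ∨ 6 < x then x else if x = 1 then 6 else if x = 6 then 1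
      else if x % 2 = 0 then x + 1 else x - 1)
    (by intro x; grind)

theorem hexA_apply (x : ℕ) :
    hexA x = if x = 0 ∨ 6 < x then x else if x % 2 = 0 then x - 1 else x + 1 := rfl

theorem hexB_apply (x : ℕ) :
    hexB x = if x = 0 ∨ 6 < x then x else if x = 1 then 6 else if x = 6 then 1
      else if x % 2 = 0 then x + 1 else x - 1 := rfl

/-- The bitrade whose last two permutations are the edges of the standard hexagon. -/
def hexTriple : Fin 3 → Equiv.Perm ℕ := ![hexA * hexB, hexA, hexB]

/-- Labels of the cycles of the components of `hexTriple`. -/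
def hexLabel (k : Fin 3) (x : ℕ) : ℕ :=
  if x = 0 ∨ 6 < x then x + 3 else ![x % 2, (x - 1) / 2, (x / 2) % 3] k

theorem hexLabel_apply (k : Fin 3) (x : ℕ) : hexLabel k (hexTriple k x) = hexLabel k x := by
  fin_cases k <;> simp [hexLabel, hexTriple, hexA_apply, hexB_apply] <;> grind

theorem eq_of_sameCycle {σ : Equiv.Perm ℕ} {f : ℕ → ℕ} (hf : ∀ x, f (σ x) = f x) {x y : ℕ}
    (h : σ.SameCycle x y) : f x = f y := by
  obtain ⟨n, rfl⟩ := h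
  have hpow : ∀ (n : ℕ) x, f ((σ ^ n) x) = f x := by
    intro n
    induction n with
    | zero => simp
    | succ n ih => intro x; rw [pow_succ, Equiv.Perm.mul_apply, ih, hf]
  obtain ⟨n, rfl | rfl⟩ := n.eq_nat_or_neg
  · simp [hpow]
  · rw [← hpow n ((σ ^ (-(n : ℤ))) x)]
    simp

theorem zc_eq_of_label {σ : Equiv.Perm ℕ} {f : ℕ → ℕ} {n : ℕ} (hf : ∀ x, f (σ x) = f x)
    (hinj : ∀ x ∈ mov σ, ∀ y ∈ mov σ, f x = f y → y = x ∨ y = σ x ∨ y = σ (σ x))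
    (himage : f '' mov σ = Set.Iio n) : zc σ = n := by
  have hlt : ∀ x : mov σ, f x < n := fun x =>
    himage.subset (Set.mem_image_of_mem f x.2)
  let F : Quotient (cycSetoidOn σ) → Fin n :=
    Quotient.lift (fun x => ⟨f x, hlt x⟩) fun x y h => Fin.ext (eq_of_sameCycle hf h)
  have hF : Function.Bijective F := by
    constructor
    · intro q r
      refine Quotient.inductionOn₂ q r fun x y h => Quotient.sound ?_
      change σ.SameCycle x.1 y.1
      have hs := Equiv.Perm.SameCycle.refl σ x.1
      rcases hinj x x.2 y y.2 (congrArg Fin.val h) with h | h | h <;> rw [h]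
      exacts [hs.apply_right, hs.apply_right.apply_right]
    · intro m
      obtain ⟨x, hx, hm⟩ : (m : ℕ) ∈ f '' mov σ := himage ▸ m.2
      exact ⟨Quotient.mk _ ⟨x, hx⟩, Fin.ext hm⟩
  exact (Nat.card_eq_of_bijective F hF).trans (Nat.card_fin n)

theorem mov_hexTriple (k : Fin 3) : mov (hexTriple k) = Set.Icc 1 6 := by
  ext x
  fin_cases k <;> simp [mov, hexTriple, hexA_apply, hexB_apply] <;> grind

theorem Gam_hexTriple : Gam hexTriple = Set.Icc 1 6 := by
  simp [Gam, mov_hexTriple]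

theorem zc_hexTriple (k : Fin 3) : zc (hexTriple k) = ![2, 3, 3] k := by
  refine zc_eq_of_label (hexLabel_apply k) ?_ ?_
  · rw [mov_hexTriple]
    intro x hx y hy
    obtain ⟨hx1, hx6⟩ := hx
    obtain ⟨hy1, hy6⟩ := hy
    revert k
    interval_cases x <;> interval_cases y <;> decide
  · rw [mov_hexTriple]
    ext m
    constructor
    · rintro ⟨x, ⟨hx1, hx6⟩, rfl⟩
      revert k
      simp only [Set.mem_Iio]
      interval_cases x <;> decide
    · intro hm
      have hm : m < ![2, 3, 3] k := hm
      have hm3 : m < 3 := hm.trans_le ((by decide : ∀ k, ![2, 3, 3] k ≤ 3) k)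
      suffices ∃ x ∈ Finset.Icc 1 6, hexLabel k x = m by simpa using this
      revert k
      interval_cases m <;> decide

theorem exists_mem_closure_hexTriple {x : ℕ} (hx : x ∈ Set.Icc 1 6) :
    ∃ g ∈ Subgroup.closure ({hexTriple 0, hexTriple 1, hexTriple 2} : Set (Equiv.Perm ℕ)),
      g 1 = x := by
  have ha : hexA ∈ Subgroup.closure
      ({hexTriple 0, hexTriple 1, hexTriple 2} : Set (Equiv.Perm ℕ)) :=
    Subgroup.subset_closure (Or.inr (Or.inl rfl))
  have hb : hexB ∈ Subgroup.closure
      ({hexTriple 0, hexTriple 1, hexTriple 2} : Set (Equiv.Perm ℕ)) :=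
    Subgroup.subset_closure (Or.inr (Or.inr rfl))
  have hba := mul_mem hb ha
  obtain ⟨h1, h6⟩ := hx
  interval_cases x
  · exact ⟨_, one_mem _, rfl⟩
  · exact ⟨_, ha, rfl⟩
  · exact ⟨_, hba, rfl⟩
  · exact ⟨_, mul_mem ha hba, rfl⟩
  · exact ⟨_, mul_mem hba hba, rfl⟩
  · exact ⟨_, hb, rfl⟩

theorem hexTriple_mem_sphericalSix : hexTriple ∈ sphericalSix := by
  refine ⟨⟨⟨?_, ?_, ?_, ?_⟩, ?_, ?_⟩, Gam_hexTriple⟩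
  · rw [Gam_hexTriple]; exact Set.finite_Icc 1 6
  · intro x
    have ha : Function.Involutive hexA := Function.Involutive.toPerm_involutive _
    have hb : Function.Involutive hexB := Function.Involutive.toPerm_involutive _
    change hexB (hexA (hexA (hexB x))) = x
    rw [ha, hb]
  · intro i j hij x y hxy ⟨h1, h2⟩
    have h1 := eq_of_sameCycle (hexLabel_apply i) h1
    have h2 := eq_of_sameCycle (hexLabel_apply j) h2
    fin_cases i <;> fin_cases j <;> simp [hexLabel] at hij h1 h2 <;> grind
  · intro i x hx
    rw [Gam_hexTriple, ← mov_hexTriple i] at hx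
    exact hx
  · rw [TransOn, Gam_hexTriple]
    intro x hx y hy
    obtain ⟨g, hg, rfl⟩ := exists_mem_closure_hexTriple hx
    obtain ⟨h, hh, rfl⟩ := exists_mem_closure_hexTriple hy
    exact ⟨h * g⁻¹, mul_mem hh (inv_mem hg), by simp⟩
  · simp [zc_hexTriple, Gam_hexTriple]

theorem isHexagon_hexTriple : IsHexagon 0 hexTriple fun m => m + 1 := by
  have hinj : Function.Injective fun m : Fin 6 => (m : ℕ) + 1 := fun m n h =>
    Fin.ext (Nat.succ_injective h)
  refine ⟨hinj, range_eq_Icc_of_injective hinj fun m => ⟨?_, ?_⟩, by decide, by decide⟩ <;> omega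

theorem exists_mem_sphericalSix_isHexagon (i : Fin 3) :
    ∃ τ ∈ sphericalSix, ∃ p, IsHexagon i τ p := by
  have h0 := hexTriple_mem_sphericalSix
  have h1 := rotate_mem_sphericalSix h0
  have h2 := rotate_mem_sphericalSix h1
  have p0 := isHexagon_hexTriple
  have p2 := IsHexagon.rotate (i := 2) p0
  have p1 := IsHexagon.rotate (i := 1) p2
  fin_cases i
  exacts [⟨_, h0, _, p0⟩, ⟨_, h2, _, p1⟩, ⟨_, h1, _, p2⟩]

/-- There are exactly 3 τ-isomorphism classes of spherical
bitrades in τ-representation of size 6 (representatives taken, without loss of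
generality, on `Γ = {1, …, 6}`). -/
theorem count_spherical_size_six :
    Nat.card (Quotient (tauIsoSetoid
      {τ : Fin 3 → Equiv.Perm ℕ | Spherical τ ∧ Gam τ = Set.Icc 1 6})) = 3 := by
  choose τ hτ p hp using exists_mem_sphericalSix_isHexagon
  let F : Fin 3 → Quotient (tauIsoSetoid sphericalSix) := fun i => Quotient.mk _ ⟨τ i, hτ i⟩
  have hF : Function.Bijective F := by
    constructor
    · intro i j h
      have hiso : TauIso (τ i) (τ j) := Quotient.exact h
      by_contra hij
      have h1 := ((hp i).mul_self_eq_one_iff (hτ i) j).2 (Ne.symm hij)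
      exact ((hp j).mul_self_eq_one_iff (hτ j) j).1 (hiso.mul_self_eq_one h1) rfl
    · intro q
      induction q using Quotient.inductionOn with
      | h ν =>
        obtain ⟨i, q, hq⟩ := exists_isHexagon ν.2
        exact ⟨i, Quotient.sound ((hp i).tauIso hq (hτ i) ν.2)⟩
  exact (Nat.card_eq_of_bijective F hF).symm.trans (Nat.card_fin 3)
end

section
/- The number of τ-isomorphism classes of spherical bitrades in τ-representation of size 7 is exactly 1. -/
open Equiv Equiv.Perm

/-! ### Transfer between `Fin 7` and `{1, …, 7}` -/

/-- The order isomorphism of `Fin 7` with `{1, …, 7}`, as a bijection. -/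
def finSevenEquiv : Fin 7 ≃ {n : ℕ // n ∈ Set.Icc 1 7} where
  toFun i := ⟨i + 1, by simp only [Set.mem_Icc]; omega⟩
  invFun n := ⟨n.1 - 1, by have := n.2; simp only [Set.mem_Icc] at this; omega⟩
  left_inv i := by simp
  right_inv n := by
    have := n.2
    simp only [Set.mem_Icc] at this
    ext
    simp only
    omega

/-- Transfer of permutations of `Fin 7` to permutations of `ℕ` supported on `{1, …, 7}`. -/
def liftPerm : Perm (Fin 7) →* Perm ℕ := extendDomainHom finSevenEquiv

theorem liftPerm_apply (s : Perm (Fin 7)) (x : Fin 7) :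
    liftPerm s (finSevenEquiv x) = finSevenEquiv (s x) :=
  extendDomain_apply_image s finSevenEquiv x

theorem liftPerm_apply_of_notMem (s : Perm (Fin 7)) {n : ℕ} (hn : n ∉ Set.Icc 1 7) :
    liftPerm s n = n :=
  extendDomain_apply_not_subtype s finSevenEquiv hn

theorem exists_finSevenEquiv_eq {n : ℕ} (hn : n ∈ Set.Icc 1 7) :
    ∃ x : Fin 7, (finSevenEquiv x : ℕ) = n :=
  ⟨finSevenEquiv.symm ⟨n, hn⟩, by simp⟩

theorem finSevenEquiv_coe_inj {x y : Fin 7} :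
    (finSevenEquiv x : ℕ) = finSevenEquiv y ↔ x = y := by
  rw [Subtype.coe_inj, finSevenEquiv.injective.eq_iff]

theorem sameCycle_liftPerm (s : Perm (Fin 7)) {x y : Fin 7} :
    (liftPerm s).SameCycle (finSevenEquiv x) (finSevenEquiv y) ↔ s.SameCycle x y :=
  sameCycle_extendDomain

theorem mem_mov {σ : Perm ℕ} {x : ℕ} : x ∈ mov σ ↔ σ x ≠ x :=
  Iff.rfl

theorem mov_liftPerm {s : Perm (Fin 7)} (hs : ∀ x, s x ≠ x) :
    mov (liftPerm s) = Set.Icc 1 7 := by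
  ext n
  by_cases hn : n ∈ Set.Icc 1 7
  · obtain ⟨x, rfl⟩ := exists_finSevenEquiv_eq hn
    simp only [mem_mov, liftPerm_apply, ne_eq, finSevenEquiv_coe_inj]
    exact iff_of_true (hs x) hn
  · simp only [mem_mov, liftPerm_apply_of_notMem s hn, ne_eq, not_true, hn]

theorem exists_liftPerm_eq {σ : Perm ℕ} (hσ : mov σ = Set.Icc 1 7) :
    ∃ s : Perm (Fin 7), liftPerm s = σ ∧ ∀ x, s x ≠ x := by
  have hmem : ∀ n, σ n ∈ Set.Icc 1 7 ↔ n ∈ Set.Icc 1 7 := by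
    intro n
    simp only [← hσ, mem_mov, ne_eq, σ.injective.eq_iff]
  refine ⟨finSevenEquiv.symm.permCongr (σ.subtypePerm hmem), ?_, ?_⟩
  · ext n
    by_cases hn : n ∈ Set.Icc 1 7
    · obtain ⟨x, rfl⟩ := exists_finSevenEquiv_eq hn
      rw [liftPerm_apply]
      simp
    · rw [liftPerm_apply_of_notMem _ hn]
      have h : n ∉ mov σ := hσ ▸ hn
      simpa [mem_mov, eq_comm] using h
  · intro x hx
    have h : (finSevenEquiv x : ℕ) ∈ mov σ := by
      rw [hσ]
      exact (finSevenEquiv x).2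
    refine h ?_
    have := congrArg (fun y => (finSevenEquiv y : ℕ)) hx
    simpa using this

theorem zc_liftPerm (s : Perm (Fin 7)) : zc (liftPerm s) = s.cycleType.card := by
  have hmov : ∀ a : mov (liftPerm s), ∃ x : Fin 7, (finSevenEquiv x : ℕ) = a := fun a =>
    exists_finSevenEquiv_eq (by_contra fun h => a.2 (liftPerm_apply_of_notMem s h))
  choose g hg using hmov
  have hg_supp : ∀ a, g a ∈ s.support := by
    intro a
    have := a.2
    rw [mem_mov, ← hg a, liftPerm_apply, ne_eq, finSevenEquiv_coe_inj] at this
    exact mem_support.2 this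
  have hcyc : ∀ a b : mov (liftPerm s),
      (liftPerm s).SameCycle a b ↔ s.cycleOf (g a) = s.cycleOf (g b) := by
    intro a b
    rw [← hg a, ← hg b, sameCycle_liftPerm,
      sameCycle_iff_cycleOf_eq_of_mem_support (hg_supp a) (hg_supp b)]
  let F : Quotient (cycSetoidOn (liftPerm s)) → s.cycleFactorsFinset :=
    Quotient.lift
      (fun a => ⟨s.cycleOf (g a), cycleOf_mem_cycleFactorsFinset_iff.2 (hg_supp a)⟩)
      (fun a b h => Subtype.ext ((hcyc a b).1 h))
  have hF : Function.Bijective F := by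
    constructor
    · intro a b
      induction a using Quotient.inductionOn with | _ a
      induction b using Quotient.inductionOn with | _ b
      intro h
      exact Quotient.sound ((hcyc a b).2 (congrArg Subtype.val h))
    · rintro ⟨c, hc⟩
      obtain ⟨x, hx⟩ := (mem_cycleFactorsFinset_iff.1 hc).1.nonempty_support
      have hxs : s x ≠ x := mem_support.1 (mem_cycleFactorsFinset_support_le hc hx)
      let a : mov (liftPerm s) := ⟨finSevenEquiv x, by
        rw [mem_mov, liftPerm_apply, ne_eq, finSevenEquiv_coe_inj]
        exact hxs⟩
      have ha : g a = x := finSevenEquiv_coe_inj.1 (hg a)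
      refine ⟨Quotient.mk _ a, Subtype.ext ?_⟩
      change s.cycleOf (g a) = c
      rw [ha, ← cycle_is_cycleOf hx hc]
  rw [zc, Nat.card_eq_of_bijective F hF, Nat.card_eq_fintype_card, Fintype.card_coe,
    cycleType_def, Multiset.card_map]
  rfl

/-! ### Cycle types of fixed-point-free permutations of seven points -/

theorem sum_cycleType_of_forall_ne {s : Perm (Fin 7)} (hs : ∀ x, s x ≠ x) :
    s.cycleType.sum = 7 := by
  have : s.support = Finset.univ := by
    ext x
    simp [hs x]
  rw [sum_cycleType, this]
  rfl

theorem card_cycleType_le_three {s : Perm (Fin 7)} (hs : ∀ x, s x ≠ x) :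
    s.cycleType.card ≤ 3 := by
  have h := Multiset.card_nsmul_le_sum (s := s.cycleType) (a := 2)
    (fun _ => two_le_of_mem_cycleType)
  rw [sum_cycleType_of_forall_ne hs, smul_eq_mul] at h
  omega

theorem cycleType_eq_of_card_eq_three {s : Perm (Fin 7)} (hs : ∀ x, s x ≠ x)
    (hcard : s.cycleType.card = 3) : s.cycleType = {3, 2, 2} := by
  obtain ⟨a, b, c, h⟩ := Multiset.card_eq_three.1 hcard
  have hsum := sum_cycleType_of_forall_ne hs
  have h2 : ∀ n ∈ s.cycleType, 2 ≤ n := fun _ => two_le_of_mem_cycleType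
  rw [h] at hsum h2
  have ha := h2 a (by simp)
  have hb := h2 b (by simp)
  have hc := h2 c (by simp)
  simp only [Multiset.insert_eq_cons, Multiset.sum_cons, Multiset.sum_singleton] at hsum
  rw [h]
  obtain ⟨rfl, rfl, rfl⟩ | ⟨rfl, rfl, rfl⟩ | ⟨rfl, rfl, rfl⟩ :
      (a = 3 ∧ b = 2 ∧ c = 2) ∨ (a = 2 ∧ b = 3 ∧ c = 2) ∨ (a = 2 ∧ b = 2 ∧ c = 3) := by
    omega
  all_goals decide

/-! ### The model bitrade -/

/-- The first permutation `(0 1 2)(3 4)(5 6)` of the model bitrade. -/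
def modelFst : Perm (Fin 7) := swap 0 1 * swap 1 2 * swap 3 4 * swap 5 6

/-- The second permutation `(1 4 6)(0 3)(2 5)` of the model bitrade. -/
def modelSnd : Perm (Fin 7) := swap 1 4 * swap 4 6 * swap 0 3 * swap 2 5

/-- The model spherical bitrade of size seven, on `Fin 7`. -/
def model : Fin 3 → Perm (Fin 7) := ![modelFst, modelSnd, (modelSnd * modelFst)⁻¹]

/-- Two fixed-point-free maps do not agree on short orbit segments, as is the case for two
permutations whose cycles meet in at most one point. -/
def Transverse (p q : Fin 7 → Fin 7) : Prop :=
  ∀ x, p x ≠ q x ∧ p x ≠ q (q x) ∧ p (p x) ≠ q x ∧ (p (p x) = q (q x) → p (p x) = x)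

instance (p q : Fin 7 → Fin 7) : Decidable (Transverse p q) :=
  inferInstanceAs (Decidable (∀ _, _))

theorem transverse_of_sameCycle {p q : Perm (Fin 7)} (hp : ∀ x, p x ≠ x) (hq : ∀ x, q x ≠ x)
    (h : ∀ x y, x ≠ y → ¬(p.SameCycle x y ∧ q.SameCycle x y)) : Transverse p q := by
  have h1 : ∀ (r : Perm (Fin 7)) x, r.SameCycle x (r x) := fun r x => ⟨1, rfl⟩
  have h2 : ∀ (r : Perm (Fin 7)) x, r.SameCycle x (r (r x)) := fun r x => ⟨2, rfl⟩
  intro x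
  refine ⟨fun e => h x _ (hp x).symm ⟨h1 p x, e ▸ h1 q x⟩,
    fun e => h x _ (hp x).symm ⟨h1 p x, e ▸ h2 q x⟩,
    fun e => h x _ (hq x).symm ⟨e ▸ h2 p x, h1 q x⟩, fun e => ?_⟩
  by_contra hne
  exact h x _ (Ne.symm hne) ⟨h2 p x, e ▸ h2 q x⟩

/-- The elements of the centralizer of `modelFst`. -/
def modelCentralizer (i : Fin 3) (j k l : Fin 2) : Perm (Fin 7) :=
  (swap 0 1 * swap 1 2) ^ (i : ℕ) * swap 3 4 ^ (j : ℕ) * swap 5 6 ^ (k : ℕ) *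
    (swap 3 5 * swap 4 6) ^ (l : ℕ)

theorem modelCentralizer_commute :
    ∀ i j k l x, modelCentralizer i j k l (modelFst x) = modelFst (modelCentralizer i j k l x) := by
  decide

set_option synthInstance.maxSize 1024 in
set_option maxRecDepth 100000 in
theorem exists_modelCentralizer_of_values :
    ∀ a0 : Fin 7, a0 ∉ [0, 1, 2] → ∀ a1, a1 ∉ [0, 1, 2, a0] → ∀ a2, a2 ∉ [0, 1, 2, a0, a1] →
    ∀ a3, a3 ∉ [3, 4, a0, a1, a2] → ∀ a4, a4 ∉ [3, 4, a0, a1, a2, a3] →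
    ∀ a5, a5 ∉ [5, 6, a0, a1, a2, a3, a4] → ∀ a6, a6 ∉ [5, 6, a0, a1, a2, a3, a4, a5] →
    Transverse modelFst ![a0, a1, a2, a3, a4, a5, a6] →
    Transverse modelFst (fun x : Fin 7 => ![a0, a1, a2, a3, a4, a5, a6] (modelFst x)) →
    Transverse ![a0, a1, a2, a3, a4, a5, a6]
      (fun x : Fin 7 => ![a0, a1, a2, a3, a4, a5, a6] (modelFst x)) →
    ∃ i j k l, ∀ x : Fin 7, modelCentralizer i j k l (![a0, a1, a2, a3, a4, a5, a6] x) =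
      modelSnd (modelCentralizer i j k l x) := by
  decide

theorem exists_modelCentralizer_of_transverse {q : Perm (Fin 7)} (hq : ∀ x, q x ≠ x)
    (h01 : Transverse modelFst q) (h02 : Transverse modelFst ⇑(q * modelFst))
    (h12 : Transverse q ⇑(q * modelFst)) :
    ∃ i j k l, ∀ x, modelCentralizer i j k l (q x) = modelSnd (modelCentralizer i j k l x) := by
  have hvec : ⇑q = ![q 0, q 1, q 2, q 3, q 4, q 5, q 6] := by
    funext x
    fin_cases x <;> rfl
  have hne : ∀ x y, x ≠ y → q x ≠ q y := fun x y hxy => q.injective.ne hxy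
  have hc : ∀ x, q x ≠ modelFst x ∧ q x ≠ modelFst (modelFst x) := fun x =>
    ⟨(h01 x).1.symm, (h01 x).2.2.1.symm⟩
  have hmul : ⇑(q * modelFst) = fun x => q (modelFst x) := rfl
  rw [hmul] at h02 h12
  have key := exists_modelCentralizer_of_values (q 0) ?_ (q 1) ?_ (q 2) ?_ (q 3) ?_ (q 4) ?_
    (q 5) ?_ (q 6) ?_
  · rw [← hvec] at key
    exact key h01 h02 h12
  all_goals simp only [List.mem_cons, List.not_mem_nil, or_false, not_or]
  · exact ⟨hq 0, (hc 0).1, (hc 0).2⟩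
  · exact ⟨(hc 1).2, hq 1, (hc 1).1, hne _ _ (by decide)⟩
  · refine ⟨(hc 2).1, (hc 2).2, hq 2, ?_, ?_⟩ <;> exact hne _ _ (by decide)
  · refine ⟨hq 3, (hc 3).1, ?_, ?_, ?_⟩ <;> exact hne _ _ (by decide)
  · refine ⟨(hc 4).1, hq 4, ?_, ?_, ?_, ?_⟩ <;> exact hne _ _ (by decide)
  · refine ⟨hq 5, (hc 5).1, ?_, ?_, ?_, ?_, ?_⟩ <;> exact hne _ _ (by decide)
  · refine ⟨(hc 6).1, hq 6, ?_, ?_, ?_, ?_, ?_, ?_⟩ <;> exact hne _ _ (by decide)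

theorem model_apply_ne : ∀ i x, model i x ≠ x := by
  decide

theorem card_cycleType_modelFst : modelFst.cycleType.card = 3 := by
  decide

theorem card_cycleType_model (i : Fin 3) : (model i).cycleType.card = 3 := by
  have hconj : ∃ θ : Perm (Fin 7), θ * modelFst * θ⁻¹ = model i := by
    fin_cases i
    · exact ⟨1, by decide⟩
    · exact ⟨swap 0 1 * swap 1 4 * swap 4 3 * swap 2 6 * swap 6 5, by decide⟩
    · exact ⟨swap 0 2 * swap 2 3 * swap 1 6 * swap 6 5, by decide⟩
  obtain ⟨θ, hθ⟩ := hconj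
  rw [← hθ, cycleType_conj, card_cycleType_modelFst]

theorem eq_of_sameCycle_s17 {α β : Type*} {p : Perm α} {f : α → β} (hf : ∀ x, f (p x) = f x)
    {x y : α} (h : p.SameCycle x y) : f x = f y := by
  obtain ⟨n, rfl⟩ := h
  induction n with
  | zero => rfl
  | succ n ih => rw [ih, add_comm, zpow_add, zpow_one, mul_apply, hf]
  | pred n ih =>
    rw [ih, ← hf ((p ^ (-(n : ℤ) - 1)) x), ← mul_apply, ← zpow_one_add]
    congr 3
    omega

/-- A labelling of the cycles of the permutations of `model`. -/
def modelLabel : Fin 3 → Fin 7 → Fin 3 :=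
  ![![0, 0, 0, 1, 1, 2, 2], ![0, 1, 2, 0, 1, 2, 1], ![0, 1, 2, 2, 0, 1, 2]]

theorem modelLabel_apply : ∀ i x, modelLabel i (model i x) = modelLabel i x := by
  decide

theorem modelLabel_separates : ∀ i j, i < j → ∀ x y, modelLabel i x = modelLabel i y →
    modelLabel j x = modelLabel j y → x = y := by
  decide

theorem exists_model_word : ∀ x y : Fin 7, ∃ i j k l m : Fin 3,
    (modelFst ^ (i : ℕ) * modelSnd ^ (j : ℕ) * modelFst ^ (k : ℕ) * modelSnd ^ (l : ℕ) *
      modelFst ^ (m : ℕ)) x = y := by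
  decide

theorem gam_liftPerm {s : Fin 3 → Perm (Fin 7)} (hs : ∀ i x, s i x ≠ x) :
    Gam (fun i => liftPerm (s i)) = Set.Icc 1 7 := by
  simp only [Gam, mov_liftPerm (hs _), Set.union_self]

theorem spherical_model : Spherical (fun i => liftPerm (model i)) := by
  have hGam := gam_liftPerm model_apply_ne
  refine ⟨⟨hGam ▸ Set.finite_Icc 1 7, fun x => ?_, ?_, fun i x hx => ?_⟩, ?_, ?_⟩
  · have : model 2 * model 1 * model 0 = 1 := by
      rw [mul_assoc]
      exact inv_mul_cancel _
    rw [← mul_apply, ← mul_apply, ← map_mul, ← map_mul, this, map_one, one_apply]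
  · rintro i j hij x y hxy ⟨hi, hj⟩
    by_cases hx : x ∈ Set.Icc 1 7
    · by_cases hy : y ∈ Set.Icc 1 7
      · obtain ⟨x, rfl⟩ := exists_finSevenEquiv_eq hx
        obtain ⟨y, rfl⟩ := exists_finSevenEquiv_eq hy
        rw [sameCycle_liftPerm] at hi hj
        rw [modelLabel_separates i j hij x y (eq_of_sameCycle_s17 (modelLabel_apply i) hi)
          (eq_of_sameCycle_s17 (modelLabel_apply j) hj)] at hxy
        exact hxy rfl
      · exact hxy (hi.eq_of_right (liftPerm_apply_of_notMem _ hy))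
    · exact hxy (hi.eq_of_left (liftPerm_apply_of_notMem _ hx))
  · rw [hGam, ← mov_liftPerm (model_apply_ne i)] at hx
    exact hx
  · intro x hx y hy
    rw [hGam] at hx hy
    obtain ⟨x, rfl⟩ := exists_finSevenEquiv_eq hx
    obtain ⟨y, rfl⟩ := exists_finSevenEquiv_eq hy
    obtain ⟨i, j, k, l, m, h⟩ := exists_model_word x y
    refine ⟨liftPerm (modelFst ^ (i : ℕ) * modelSnd ^ (j : ℕ) * modelFst ^ (k : ℕ) *
      modelSnd ^ (l : ℕ) * modelFst ^ (m : ℕ)), ?_, by rw [liftPerm_apply, h]⟩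
    have h0 : liftPerm modelFst ∈ Subgroup.closure ({liftPerm (model 0), liftPerm (model 1),
        liftPerm (model 2)} : Set (Perm ℕ)) := Subgroup.subset_closure (Or.inl rfl)
    have h1 : liftPerm modelSnd ∈ Subgroup.closure ({liftPerm (model 0), liftPerm (model 1),
        liftPerm (model 2)} : Set (Perm ℕ)) := Subgroup.subset_closure (Or.inr (Or.inl rfl))
    simp only [map_mul, map_pow]
    exact mul_mem (mul_mem (mul_mem (mul_mem (pow_mem h0 _) (pow_mem h1 _)) (pow_mem h0 _))
      (pow_mem h1 _)) (pow_mem h0 _)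
  · rw [hGam]
    simp only [zc_liftPerm, card_cycleType_model]
    simp

/-! ### Uniqueness -/

theorem tauIso_model {τ : Fin 3 → Perm ℕ} (hτ : Spherical τ) (hGam : Gam τ = Set.Icc 1 7) :
    TauIso τ (fun i => liftPerm (model i)) := by
  obtain ⟨⟨-, t1, t2, t3⟩, -, hz⟩ := hτ
  have hsub : ∀ i, mov (τ i) ⊆ Gam τ := by
    intro i x hx
    fin_cases i
    exacts [Or.inl (Or.inl hx), Or.inl (Or.inr hx), Or.inr hx]
  have hmov : ∀ i, mov (τ i) = Set.Icc 1 7 := fun i =>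
    hGam ▸ (hsub i).antisymm fun x hx => t3 i x hx
  choose s hs hne using fun i => exists_liftPerm_eq (hmov i)
  obtain rfl : (fun i => liftPerm (s i)) = τ := funext hs
  clear hs
  simp only at t1 t2 hz
  rw [hGam] at hz
  simp only [zc_liftPerm, Nat.card_eq_card_toFinset, Set.toFinset_Icc, Nat.card_Icc] at hz
  have hle := fun i => card_cycleType_le_three (hne i)
  have hcard : (s 0).cycleType.card = 3 := by
    have h0 := hle 0
    have h1 := hle 1
    have h2 := hle 2
    omega
  obtain ⟨θ, hθ⟩ := isConj_iff.1 (isConj_iff_cycleType_eq.2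
    ((cycleType_eq_of_card_eq_three (hne 0) hcard).trans
      (cycleType_eq_of_card_eq_three (model_apply_ne 0) (card_cycleType_model 0)).symm))
  have hprod : s 2 = (s 1 * s 0)⁻¹ := by
    rw [eq_inv_iff_mul_eq_one]
    ext x
    have := t1 (finSevenEquiv x)
    rw [liftPerm_apply, liftPerm_apply, liftPerm_apply, finSevenEquiv_coe_inj] at this
    simp [this]
  have hT : ∀ i j, i < j → ∀ x y, x ≠ y → ¬((s i).SameCycle x y ∧ (s j).SameCycle x y) := by
    intro i j hij x y hxy h
    refine t2 i j hij (finSevenEquiv x) (finSevenEquiv y) (by rwa [ne_eq, finSevenEquiv_coe_inj]) ?_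
    rwa [sameCycle_liftPerm, sameCycle_liftPerm]
  have hconj_ne : ∀ (p : Perm (Fin 7)), (∀ x, p x ≠ x) → ∀ x, (θ * p * θ⁻¹) x ≠ x := by
    intro p hp x hx
    exact hp (θ⁻¹ x) (by rw [eq_inv_iff_eq]; exact hx)
  have hconj : ∀ p q : Perm (Fin 7), (∀ x, p x ≠ x) → (∀ x, q x ≠ x) →
      (∀ x y, x ≠ y → ¬(p.SameCycle x y ∧ q.SameCycle x y)) →
      Transverse ⇑(θ * p * θ⁻¹) ⇑(θ * q * θ⁻¹) := by
    intro p q hp hq h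
    refine transverse_of_sameCycle (hconj_ne p hp) (hconj_ne q hq) fun x y hxy => ?_
    rw [sameCycle_conj, sameCycle_conj]
    exact h _ _ (θ⁻¹.injective.ne hxy)
  have hinv : s 1 * s 0 = (s 2)⁻¹ := by rw [hprod, inv_inv]
  have hne' : ∀ x, (s 1 * s 0) x ≠ x := by
    intro x hx
    rw [hinv, inv_eq_iff_eq] at hx
    exact hne 2 x hx.symm
  have hmul : θ * s 1 * θ⁻¹ * modelFst = θ * (s 1 * s 0) * θ⁻¹ := by
    change _ * model 0 = _
    rw [← hθ]
    group
  have hθ' : θ * s 0 * θ⁻¹ = modelFst := hθ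
  obtain ⟨i, j, k, l, hφ⟩ := exists_modelCentralizer_of_transverse (q := θ * s 1 * θ⁻¹)
    (hconj_ne _ (hne 1))
    (hθ' ▸ hconj _ _ (hne 0) (hne 1) (hT 0 1 (by decide)))
    (by
      rw [hmul, ← hθ']
      refine hconj _ _ (hne 0) hne' ?_
      simpa only [hinv, sameCycle_inv] using hT 0 2 (by decide))
    (by
      rw [hmul]
      refine hconj _ _ (hne 1) hne' ?_
      simpa only [hinv, sameCycle_inv] using hT 1 2 (by decide))
  set φ := modelCentralizer i j k l with hφ_def
  have h0 : φ * θ * s 0 * (φ * θ)⁻¹ = modelFst := by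
    have : φ * modelFst = modelFst * φ := Equiv.ext (modelCentralizer_commute i j k l)
    rw [← hθ'] at this ⊢
    rw [mul_inv_rev, ← mul_inv_eq_iff_eq_mul.2 this]
    group
  have h1 : φ * θ * s 1 * (φ * θ)⁻¹ = modelSnd := by
    have : φ * (θ * s 1 * θ⁻¹) = modelSnd * φ := Equiv.ext hφ
    rw [← mul_inv_eq_iff_eq_mul.2 this]
    group
  have h2 : φ * θ * s 2 * (φ * θ)⁻¹ = (modelSnd * modelFst)⁻¹ := by
    rw [hprod, ← h0, ← h1]
    group
  refine ⟨liftPerm (φ * θ), fun i => ?_⟩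
  rw [← map_inv, ← map_mul, ← map_mul]
  congr 1
  fin_cases i
  exacts [h0, h1, h2]

/-- There is exactly 1 τ-isomorphism class of spherical
bitrades in τ-representation of size 7 (representatives taken, without loss of
generality, on `Γ = {1, …, 7}`). -/
theorem count_spherical_size_seven :
    Nat.card (Quotient (tauIsoSetoid
      {τ : Fin 3 → Equiv.Perm ℕ | Spherical τ ∧ Gam τ = Set.Icc 1 7})) = 1 := by
  rw [Nat.card_eq_one_iff_unique]
  constructor
  · refine ⟨fun a b => ?_⟩
    induction a using Quotient.inductionOn with | _ a
    induction b using Quotient.inductionOn with | _ b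
    have ha := tauIso_model a.2.1 a.2.2
    have hb := tauIso_model b.2.1 b.2.2
    let m : {τ : Fin 3 → Equiv.Perm ℕ | Spherical τ ∧ Gam τ = Set.Icc 1 7} :=
      ⟨_, spherical_model, gam_liftPerm model_apply_ne⟩
    exact (Quotient.sound (s := tauIsoSetoid _) (b := m) ha).trans
      (Quotient.sound (s := tauIsoSetoid _) (b := m) hb).symm
  · exact ⟨Quotient.mk _ ⟨_, spherical_model, gam_liftPerm model_apply_ne⟩⟩
end
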